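/- Let G be a connected finite simple graph on n vertices with Laplacian matrix L, and let B = diag(b₁, …, bₙ) with bᵢ ≥ 0 and at least one bⱼ > 0; set Q = L + B (a positive definite matrix with smallest eigenvalue λ₁(Q) > 0). Let ξ be a time-based generator on [0, t_b] with parameters k > 0 and δ > 0, and h(t) = k ξ'(t)/(1 − ξ(t) + δ). Let M ≥ 0, c₂ > M, c₁ ≥ 1/(2λ₁(Q)). Suppose β̃ : ℝ → ℝⁿ is differentiable and g : ℝ → ℝⁿ satisfies |gᵢ(t)| ≤ M for all i and t, and β̃'(t) = −c₁ h(t) Q β̃(t) − c₂ sgn(Q β̃(t)) + g(t) for all t ∈ [0, t_b]. Then β̃(t)ᵀ Q β̃(t) ≤ ((1 − ξ(t) + δ)/(1 + δ))^k · β̃(0)ᵀ Q β̃(0) for every t ∈ [0, t_b]; in particular β̃(t_b)ᵀ Q β̃(t_b) ≤ (δ/(1+δ))^k · β̃(0)ᵀ Q β̃(0). -/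

import Mathlib

open Matrix

/-- A time-based generator on `[0, ts]`: a differentiable nondecreasing function
`ξ : ℝ → ℝ` with `ξ 0 = 0`, `ξ ts = 1`, and `0 ≤ ξ t ≤ 1` on `[0, ts]`. -/
def IsTimeBasedGenerator (ts : ℝ) (ξ : ℝ → ℝ) : Prop :=
  Differentiable ℝ ξ ∧ Monotone ξ ∧ ξ 0 = 0 ∧ ξ ts = 1 ∧
    ∀ t ∈ Set.Icc (0 : ℝ) ts, 0 ≤ ξ t ∧ ξ t ≤ 1

/-- The Laplacian of a connected graph, perturbed by a nonzero nonnegative diagonal, is positive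
definite. -/
theorem SimpleGraph.Connected.posDef_lapMatrix_add_diagonal {V : Type*} [Fintype V] [DecidableEq V]
    {G : SimpleGraph V} [DecidableRel G.Adj] (hG : G.Connected) {b : V → ℝ} (hb : ∀ i, 0 ≤ b i)
    {j : V} (hbj : 0 < b j) : (G.lapMatrix ℝ + diagonal b).PosDef := by
  have hL := G.posSemidef_lapMatrix ℝ
  have hD : (diagonal b).PosSemidef := .diagonal hb
  refine .of_dotProduct_mulVec_pos (hL.add hD).isHermitian fun x hx ↦ ?_
  have hLx := hL.dotProduct_mulVec_nonneg x
  have hDx := hD.dotProduct_mulVec_nonneg x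
  rw [add_mulVec, dotProduct_add]
  refine (add_nonneg hLx hDx).lt_of_ne' fun h0 ↦ hx ?_
  obtain ⟨hL0, hD0⟩ := (add_eq_zero_iff_of_nonneg hLx hDx).1 h0
  have hconst := (G.lapMatrix_mulVec_eq_zero_iff_forall_reachable).1
    ((hL.dotProduct_mulVec_zero_iff x).1 hL0)
  have hxj : x j = 0 := by
    have := congrFun ((hD.dotProduct_mulVec_zero_iff x).1 hD0) j
    simpa [mulVec_diagonal, hbj.ne'] using this
  ext i
  rw [hconst i j (hG i j), hxj, Pi.zero_apply]

/-- A Hermitian real matrix dominates any lower bound of its eigenvalues. -/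
theorem Matrix.IsHermitian.posSemidef_sub_smul_one {ι : Type*} [Fintype ι] [DecidableEq ι]
    {Q : Matrix ι ι ℝ} (hQ : Q.IsHermitian) {l : ℝ}
    (hl : ∀ r : ℝ, ∀ v : ι → ℝ, v ≠ 0 → Q *ᵥ v = r • v → l ≤ r) :
    (Q - l • (1 : Matrix ι ι ℝ)).PosSemidef := by
  have hP : (Q - l • (1 : Matrix ι ι ℝ)).IsHermitian := by
    refine hQ.sub ?_
    simp [IsHermitian]
  rw [hP.posSemidef_iff_eigenvalues_nonneg]
  intro i
  have hv := hP.mulVec_eigenvectorBasis i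
  have hne : (hP.eigenvectorBasis i : ι → ℝ) ≠ 0 := fun h0 ↦
    hP.eigenvectorBasis.orthonormal.ne_zero i (by ext m; exact congrFun h0 m)
  rw [sub_mulVec, smul_mulVec, one_mulVec, sub_eq_iff_eq_add, ← add_smul] at hv
  simpa using hl _ _ hne hv

/-- If `l ≥ 0` bounds the eigenvalues of `Q` from below, then `l * (v ⬝ᵥ Q v) ≤ ‖Q v‖²`. -/
theorem Matrix.IsHermitian.mul_dotProduct_mulVec_le {ι : Type*} [Fintype ι] [DecidableEq ι]
    {Q : Matrix ι ι ℝ} (hQ : Q.IsHermitian) {l : ℝ} (hl0 : 0 ≤ l)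
    (hl : ∀ r : ℝ, ∀ v : ι → ℝ, v ≠ 0 → Q *ᵥ v = r • v → l ≤ r) (v : ι → ℝ) :
    l * (v ⬝ᵥ (Q *ᵥ v)) ≤ (Q *ᵥ v) ⬝ᵥ (Q *ᵥ v) := by
  have hP := (hQ.posSemidef_sub_smul_one hl).dotProduct_mulVec_nonneg v
  simp only [star_trivial, sub_mulVec, smul_mulVec, one_mulVec, dotProduct_sub,
    dotProduct_smul, smul_eq_mul] at hP
  have hsq : 0 ≤ (Q *ᵥ v - l • v) ⬝ᵥ (Q *ᵥ v - l • v) :=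
    Finset.sum_nonneg fun i _ ↦ mul_self_nonneg _
  simp only [dotProduct_sub, sub_dotProduct, smul_dotProduct, dotProduct_smul, smul_eq_mul,
    dotProduct_comm (Q *ᵥ v) v] at hsq
  nlinarith [mul_nonneg hl0 hP]

/-- Derivative of a symmetric quadratic form along a curve. -/
theorem Matrix.IsSymm.hasDerivAt_dotProduct_mulVec {ι : Type*} [Fintype ι]
    {Q : Matrix ι ι ℝ} (hQ : Q.IsSymm) {x : ℝ → ι → ℝ} {x' : ι → ℝ} {t : ℝ}
    (hx : HasDerivAt x x' t) :
    HasDerivAt (fun s ↦ x s ⬝ᵥ (Q *ᵥ x s)) (2 * ((Q *ᵥ x t) ⬝ᵥ x')) t := by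
  have hxi := hasDerivAt_pi.1 hx
  have hQx (i : ι) : HasDerivAt (fun s ↦ (Q *ᵥ x s) i) ((Q *ᵥ x') i) t :=
    HasDerivAt.fun_sum fun m _ ↦ (hxi m).const_mul (Q i m)
  have h : HasDerivAt (fun s ↦ x s ⬝ᵥ (Q *ᵥ x s)) (x' ⬝ᵥ (Q *ᵥ x t) + x t ⬝ᵥ (Q *ᵥ x')) t := by
    simp only [dotProduct, ← Finset.sum_add_distrib]
    exact HasDerivAt.fun_sum fun i _ ↦ (hxi i).mul (hQx i)
  convert h using 1
  rw [dotProduct_mulVec (x t), ← mulVec_transpose, hQ.eq, dotProduct_comm x', two_mul]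

/-- A differential inequality `V' ≤ -k φ' / (1 - φ + δ) V` with `φ ≤ 1` forces the decay
`V ≤ ((1 - φ + δ) / (1 + δ)) ^ k V 0`. -/
theorem IsTimeBasedGenerator.le_rpow_mul_of_deriv_le {ts k δ : ℝ} {ξ V V' : ℝ → ℝ}
    (hξ : IsTimeBasedGenerator ts ξ) (hδ : 0 < δ)
    (hV : ∀ t ∈ Set.Icc 0 ts, HasDerivAt V (V' t) t)
    (hV' : ∀ t ∈ Set.Icc 0 ts, V' t ≤ -(k * deriv ξ t / (1 - ξ t + δ)) * V t)
    {t : ℝ} (ht : t ∈ Set.Icc 0 ts) :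
    V t ≤ ((1 - ξ t + δ) / (1 + δ)) ^ k * V 0 := by
  obtain ⟨hdiff, -, h0, -, hbd⟩ := hξ
  have hpos (s) (hs : s ∈ Set.Icc 0 ts) : 0 < 1 - ξ s + δ := by linarith [(hbd s hs).2]
  have hW (s) (hs : s ∈ Set.Icc 0 ts) :
      HasDerivAt (fun r ↦ V r * (1 - ξ r + δ) ^ (-k))
        (V' s * (1 - ξ s + δ) ^ (-k) +
          V s * (-deriv ξ s * (-k) * (1 - ξ s + δ) ^ (-k - 1))) s :=
    (hV s hs).mul (((((hdiff s).hasDerivAt).const_sub 1).add_const δ).rpow_const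
      (.inl (hpos s hs).ne'))
  have hanti : AntitoneOn (fun r ↦ V r * (1 - ξ r + δ) ^ (-k)) (Set.Icc 0 ts) := by
    refine antitoneOn_of_deriv_nonpos (convex_Icc _ _)
      (fun s hs ↦ (hW s hs).continuousAt.continuousWithinAt)
      (fun s hs ↦ (hW s (interior_subset hs)).differentiableAt.differentiableWithinAt)
      fun s hs ↦ ?_
    replace hs := interior_subset hs
    have hp := hpos s hs
    rw [(hW s hs).deriv, Real.rpow_sub_one hp.ne']
    calc _ = (V' s + k * deriv ξ s / (1 - ξ s + δ) * V s) * (1 - ξ s + δ) ^ (-k) := by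
            field_simp
      _ ≤ 0 := mul_nonpos_of_nonpos_of_nonneg (by linarith [hV' s hs]) (by positivity)
  have hp := hpos t ht
  have hle := hanti ⟨le_rfl, ht.1.trans ht.2⟩ ht ht.1
  simp only [h0, sub_zero, Real.rpow_neg hp.le, Real.rpow_neg (by positivity : 0 ≤ 1 + δ)] at hle
  rw [Real.div_rpow hp.le (by positivity)]
  calc V t = V t * ((1 - ξ t + δ) ^ k)⁻¹ * (1 - ξ t + δ) ^ k := by field_simp
    _ ≤ V 0 * ((1 + δ) ^ k)⁻¹ * (1 - ξ t + δ) ^ k := by gcongr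
    _ = _ := by ring

/-- The switching term with gain `c ≥ M` dominates any perturbation bounded by `M`. -/
theorem Real.mul_sub_mul_sign_nonpos {c M y g : ℝ} (hc : M ≤ c) (hg : |g| ≤ M) :
    y * (g - c * Real.sign y) ≤ 0 := by
  obtain ⟨h₁, h₂⟩ := abs_le.1 hg
  rcases lt_trichotomy y 0 with hy | rfl | hy
  · rw [Real.sign_of_neg hy]; nlinarith
  · simp
  · rw [Real.sign_of_pos hy]; nlinarith

/-- fixed-time convergence of the velocity-observer error.  Let
`G` be a connected graph with Laplacian `L`, `B = diag(b)` with `bᵢ ≥ 0` and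
some `bⱼ > 0`, and `Q = L + B` (positive definite, smallest eigenvalue
`λ₁(Q) > 0`).  With a time-based generator `ξ` on `[0, t_b]`, gain
`h(t) = k ξ'(t)/(1 − ξ(t) + δ)`, `M ≥ 0`, `c₂ > M`, `c₁ ≥ 1/(2λ₁(Q))`,
bounded `g` (`|gᵢ(t)| ≤ M`) and error dynamics
`β̃' = −c₁ h Q β̃ − c₂ sgn(Q β̃) + g` on `[0, t_b]`, one has
`β̃(t)ᵀQβ̃(t) ≤ ((1 − ξ(t) + δ)/(1 + δ))^k β̃(0)ᵀQβ̃(0)` on `[0, t_b]`;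
in particular `β̃(t_b)ᵀQβ̃(t_b) ≤ (δ/(1 + δ))^k β̃(0)ᵀQβ̃(0)`. -/
theorem stmt17 (n : ℕ) (G : SimpleGraph (Fin n)) [DecidableRel G.Adj]
    (hG : G.Connected) (b : Fin n → ℝ) (hb : ∀ i, 0 ≤ b i)
    (j : Fin n) (hbj : 0 < b j)
    (Q : Matrix (Fin n) (Fin n) ℝ) (hQ : Q = G.lapMatrix ℝ + Matrix.diagonal b)
    (lam1 : ℝ)
    (hlam1 : IsLeast {r : ℝ | ∃ v : Fin n → ℝ, v ≠ 0 ∧ Q *ᵥ v = r • v} lam1)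
    (tb k δ : ℝ) (htb : 0 < tb) (hk : 0 < k) (hδ : 0 < δ)
    (ξ : ℝ → ℝ) (hξ : IsTimeBasedGenerator tb ξ)
    (h : ℝ → ℝ) (hh : ∀ t : ℝ, h t = k * deriv ξ t / (1 - ξ t + δ))
    (M c₁ c₂ : ℝ) (hM : 0 ≤ M) (hc₂ : M < c₂) (hc₁ : 1 / (2 * lam1) ≤ c₁)
    (βt : ℝ → Fin n → ℝ) (hβdiff : Differentiable ℝ βt)
    (g : ℝ → Fin n → ℝ) (hg : ∀ t : ℝ, ∀ i, |g t i| ≤ M)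
    (hode : ∀ t ∈ Set.Icc (0 : ℝ) tb, deriv βt t =
      fun i => -c₁ * h t * (Q *ᵥ βt t) i - c₂ * Real.sign ((Q *ᵥ βt t) i) + g t i) :
    (∀ t ∈ Set.Icc (0 : ℝ) tb,
        βt t ⬝ᵥ (Q *ᵥ βt t) ≤ ((1 - ξ t + δ) / (1 + δ)) ^ k * (βt 0 ⬝ᵥ (Q *ᵥ βt 0))) ∧
      βt tb ⬝ᵥ (Q *ᵥ βt tb) ≤ (δ / (1 + δ)) ^ k * (βt 0 ⬝ᵥ (Q *ᵥ βt 0)) := by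
  have hpd : Q.PosDef := hQ ▸ hG.posDef_lapMatrix_add_diagonal hb hbj
  have hlam0 : 0 < lam1 := by
    obtain ⟨v, hv, hQv⟩ := hlam1.1
    have := hpd.dotProduct_mulVec_pos hv
    rw [hQv, dotProduct_smul, star_trivial, smul_eq_mul] at this
    exact pos_of_mul_pos_left this (Finset.sum_nonneg fun i _ ↦ mul_self_nonneg _)
  have hc : 1 ≤ 2 * c₁ * lam1 := by
    rw [div_le_iff₀ (by positivity)] at hc₁
    linarith
  have hc₁0 : 0 ≤ c₁ := le_trans (by positivity) hc₁
  have hdecay : ∀ t ∈ Set.Icc (0 : ℝ) tb,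
      βt t ⬝ᵥ (Q *ᵥ βt t) ≤ ((1 - ξ t + δ) / (1 + δ)) ^ k * (βt 0 ⬝ᵥ (Q *ᵥ βt 0)) := by
    intro t ht
    have hsymm : Q.IsSymm := (conjTranspose_eq_transpose_of_trivial Q).symm.trans hpd.isHermitian
    refine hξ.le_rpow_mul_of_deriv_le (V := fun s ↦ βt s ⬝ᵥ (Q *ᵥ βt s)) hδ
      (fun s _ ↦ hsymm.hasDerivAt_dotProduct_mulVec (hβdiff s).hasDerivAt) (fun s hs ↦ ?_) ht
    have hh0 : 0 ≤ h s := by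
      rw [hh]
      have := hξ.2.1.deriv_nonneg (x := s)
      have := (hξ.2.2.2.2 s hs).2
      exact div_nonneg (by positivity) (by linarith)
    have hV0 := hpd.posSemidef.dotProduct_mulVec_nonneg (βt s)
    have hray := hpd.isHermitian.mul_dotProduct_mulVec_le hlam0.le
      (fun r v hv hr ↦ hlam1.2 ⟨v, hv, hr⟩) (βt s)
    rw [star_trivial] at hV0
    rw [← hh, hode s hs]
    set V := βt s ⬝ᵥ (Q *ᵥ βt s)
    set y := Q *ᵥ βt s
    have hdot : (y ⬝ᵥ fun i ↦ -c₁ * h s * y i - c₂ * Real.sign (y i) + g s i) ≤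
        -c₁ * h s * (y ⬝ᵥ y) := by
      simp only [dotProduct, Finset.mul_sum]
      refine Finset.sum_le_sum fun i _ ↦ ?_
      linarith [Real.mul_sub_mul_sign_nonpos (y := y i) hc₂.le (hg s i)]
    have h₁ := mul_le_mul_of_nonneg_left hray (mul_nonneg hc₁0 hh0)
    have h₂ := mul_le_mul_of_nonneg_right hc (mul_nonneg hh0 hV0)
    linarith
  refine ⟨hdecay, ?_⟩
  simpa [hξ.2.2.2.1] using hdecay tb ⟨htb.le, le_rfl⟩
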